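/- arXiv:2302.00323 — 6 statements merged into one kernel-verified Lean document; each statement's English description precedes it below -/
import Mathlib

section
/- Let n ≥ 2 and m ≥ 1 be integers, and for each agent i ∈ Fin n let v_i be a disutility function on m objects with α_i = max_e v_i e. Then there exists an allocation A : Fin m → Fin n such that for every agent i, the disutility of i's own bundle satisfies ∑ of v_i e over objects e with A e = i ≤ V_n(α_i). -/
open Finset

/-- A (normalised, additive) disutility function on `m` objects. -/
def IsDisutility (m : ℕ) (v : Fin m → ℝ) : Prop :=
  (∀ e, 0 ≤ v e) ∧ ∑ e, v e = 1

/-- The MinMaxShare of `v` among `n` agents: the minimum over allocations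
`A : Fin m → Fin n` of the maximum bundle disutility. -/
noncomputable def MMS (n m : ℕ) (v : Fin m → ℝ) : ℝ :=
  ⨅ A : Fin m → Fin n, ⨆ j : Fin n, ∑ e ∈ Finset.univ.filter (fun e => A e = j), v e

/-- `v ∈ V(α;m)`: a disutility function on `m` objects whose maximum single-object
value equals `α`. -/
def Vmem (α : ℝ) (m : ℕ) (v : Fin m → ℝ) : Prop :=
  IsDisutility m v ∧ (⨆ e, v e) = α

/-- Hill's guarantee function `V_n : (0,1] → ℝ`.
For `α` with `1/((k+1)n+1) < α ≤ 1/(kn+1)` (so `k = ⌊(1/α - 1)/n⌋`):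
`V_n(α) = (k+2)/((k+1)n+1)` if `α < (k+2)/((k+1)((k+1)n+1))`, and
`V_n(α) = (k+1)α` otherwise. -/
noncomputable def hillV (n : ℕ) (α : ℝ) : ℝ :=
  let k : ℕ := ⌊(1/α - 1)/(n:ℝ)⌋₊
  if α < ((k:ℝ)+2)/(((k:ℝ)+1)*(((k:ℝ)+1)*(n:ℝ)+1)) then ((k:ℝ)+2)/(((k:ℝ)+1)*(n:ℝ)+1)
  else ((k:ℝ)+1)*α

/-- Hill's guarantee dominates both expressions in its definition, for a suitable `k`. -/
lemma exists_le_hillV (n : ℕ) (α : ℝ) : ∃ k : ℕ,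
    ((k : ℝ) + 2) / (((k : ℝ) + 1) * n + 1) ≤ hillV n α ∧ ((k : ℝ) + 1) * α ≤ hillV n α := by
  refine ⟨⌊(1 / α - 1) / (n : ℝ)⌋₊, ?_⟩
  unfold hillV
  generalize ⌊(1 / α - 1) / (n : ℝ)⌋₊ = k
  have hk : (0 : ℝ) < (k : ℝ) + 1 := by positivity
  have hN : (0 : ℝ) < ((k : ℝ) + 1) * n + 1 := by positivity
  have hiff : α < ((k : ℝ) + 2) / (((k : ℝ) + 1) * (((k : ℝ) + 1) * n + 1)) ↔
      ((k : ℝ) + 1) * α < ((k : ℝ) + 2) / (((k : ℝ) + 1) * n + 1) := by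
    rw [lt_div_iff₀ (by positivity), lt_div_iff₀ hN]
    ring_nf
  dsimp only
  split_ifs with h
  · exact ⟨le_rfl, (hiff.1 h).le⟩
  · exact ⟨not_lt.1 fun h' => h (hiff.2 h'), le_rfl⟩

section FirstFit

variable {ι E : Type*} [LinearOrder E] (v : ι → E → ℝ) (T : ι → ℝ)

/-- Greedily filling one bag: some agent of `S` accepts it, and every left-out object was refused
by all agents of `S` on top of the objects preceding it. -/
lemma exists_firstFit_bag {S : Finset ι} (hS : S.Nonempty) (hT : ∀ i, 0 ≤ T i) (C : Finset E) :
    ∃ B ⊆ C, (∃ i ∈ S, ∑ e ∈ B, v i e ≤ T i) ∧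
      ∀ e ∈ C, e ∉ B → ∀ i ∈ S, T i < ∑ x ∈ B with x < e, v i x + v i e := by
  induction C using Finset.induction_on_max with
  | empty =>
    obtain ⟨i, hi⟩ := hS
    exact ⟨∅, Subset.rfl, ⟨i, hi, by simpa using hT i⟩, by simp⟩
  | insert a C ha ih =>
    obtain ⟨B, hBC, ⟨i, hi, hiB⟩, hB⟩ := ih
    have haB : a ∉ B := fun h => (ha a (hBC h)).false
    by_cases hacc : ∃ j ∈ S, ∑ e ∈ B, v j e + v j a ≤ T j
    · obtain ⟨j, hj, hja⟩ := hacc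
      refine ⟨insert a B, insert_subset_insert a hBC, ⟨j, hj, ?_⟩, fun e he heB j' hj' => ?_⟩
      · rw [sum_insert haB]
        linarith
      · rw [mem_insert, not_or] at heB
        have heC := mem_of_mem_insert_of_ne he heB.1
        rw [filter_insert, if_neg (ha e heC).not_gt]
        exact hB e heC heB.2 j' hj'
    · push Not at hacc
      refine ⟨B, hBC.trans (subset_insert a C), ⟨i, hi, hiB⟩, fun e he heB j hj => ?_⟩
      rcases mem_insert.1 he with rfl | heC
      · rw [filter_true_of_mem fun x hx => ha x (hBC hx)]
        exact hacc j hj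
      · exact hB e heC heB j hj

/-- Filling one bag per agent: an object left over at the end was refused for every bag by a
common agent, namely the one receiving the last bag. -/
lemma exists_firstFit_allocation [DecidableEq ι] (hT : ∀ i, 0 ≤ T i) (S : Finset ι)
    (hS : S.Nonempty) (C : Finset E) :
    ∃ B : ι → Finset E, (∀ i ∈ S, B i ⊆ C) ∧ (∀ i ∈ S, ∀ j ∈ S, i ≠ j → Disjoint (B i) (B j)) ∧
      (∀ i ∈ S, ∑ e ∈ B i, v i e ≤ T i) ∧
      ∀ e ∈ C, (∀ i ∈ S, e ∉ B i) →
        ∃ i ∈ S, ∀ j ∈ S, T i < ∑ x ∈ B j with x < e, v i x + v i e := by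
  induction S using Finset.strongInduction generalizing C with
  | H S ih =>
    obtain ⟨b, hbC, ⟨i, hi, hib⟩, hb⟩ := exists_firstFit_bag v T hS hT C
    rcases (S.erase i).eq_empty_or_nonempty with hSi | hSi
    · have hS' : ∀ j ∈ S, j = i := fun j hj => by
        by_contra hne
        simpa [hSi] using mem_erase.2 ⟨hne, hj⟩
      refine ⟨fun _ => b, fun _ _ => hbC, fun j hj l hl hjl => ?_, fun j hj => ?_, fun e he heB => ?_⟩
      · exact absurd ((hS' j hj).trans (hS' l hl).symm) hjl
      · rwa [hS' j hj]
      · exact ⟨i, hi, fun j _ => hb e he (heB i hi) i hi⟩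
    · obtain ⟨B, hBC, hdisj, hBT, hB⟩ := ih (S.erase i) (erase_ssubset hi) hSi (C \ b)
      have hB_ne : ∀ j, j ≠ i → Function.update B i b j = B j :=
        fun j hj => Function.update_of_ne hj _ _
      have hB_disj : ∀ j ∈ S, j ≠ i → Disjoint b (B j) := fun j hj hne =>
        disjoint_sdiff.mono_right (hBC j (mem_erase.2 ⟨hne, hj⟩))
      refine ⟨Function.update B i b, fun j hj => ?_, fun j hj l hl hjl => ?_, fun j hj => ?_,
        fun e he heB => ?_⟩
      · by_cases h : j = i
        · subst h; simpa using hbC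
        · rw [hB_ne j h]
          exact (hBC j (mem_erase.2 ⟨h, hj⟩)).trans sdiff_subset
      · by_cases h : j = i
        · subst h
          rw [hB_ne l hjl.symm, Function.update_self]
          exact hB_disj l hl hjl.symm
        · by_cases h' : l = i
          · subst h'
            rw [hB_ne j h, Function.update_self]
            exact (hB_disj j hj h).symm
          · rw [hB_ne j h, hB_ne l h']
            exact hdisj j (mem_erase.2 ⟨h, hj⟩) l (mem_erase.2 ⟨h', hl⟩) hjl
      · by_cases h : j = i
        · subst h; simpa using hib
        · rw [hB_ne j h]
          exact hBT j (mem_erase.2 ⟨h, hj⟩)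
      · have heb : e ∉ b := by simpa using heB i hi
        obtain ⟨l, hl, hlB⟩ := hB e (mem_sdiff.2 ⟨he, heb⟩) fun j hj => by
          have := heB j (mem_of_mem_erase hj)
          rwa [hB_ne j (ne_of_mem_erase hj)] at this
        refine ⟨l, mem_of_mem_erase hl, fun j hj => ?_⟩
        by_cases h : j = i
        · subst h
          rw [Function.update_self]
          exact hb e he heb l (mem_of_mem_erase hl)
        · rw [hB_ne j h]
          exact hlB j (mem_erase.2 ⟨h, hj⟩)

end FirstFit

/-- An agent for whom the objects are sorted by decreasing disutility cannot refuse the same object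
on top of `n` disjoint bundles of earlier objects, if the threshold is at least Hill's guarantee. -/
lemma not_refuse_all {n m k : ℕ} (hn : 2 ≤ n) {w : Fin m → ℝ} (hw : IsDisutility m w)
    (hanti : Antitone w) {α t : ℝ} (hα : ∀ e, w e ≤ α)
    (ht : ((k : ℝ) + 2) / (((k : ℝ) + 1) * n + 1) ≤ t) (ht' : ((k : ℝ) + 1) * α ≤ t)
    {D : Fin n → Finset (Fin m)} (hD : ∀ i j, i ≠ j → Disjoint (D i) (D j)) {e : Fin m}
    (he : ∀ j, ∀ x ∈ D j, x < e) : ¬ ∀ j, t < ∑ x ∈ D j, w x + w e := by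
  intro hrefuse
  have hn' : (2 : ℝ) ≤ n := by exact_mod_cast hn
  have hN : (0 : ℝ) < ((k : ℝ) + 1) * n + 1 := by positivity
  have hα0 : 0 ≤ α := (hw.1 e).trans (hα e)
  have htotal : ∑ j, ∑ x ∈ D j, w x + w e ≤ 1 := by
    have hdisj : Set.PairwiseDisjoint (↑(univ : Finset (Fin n))) D := fun i _ j _ hij => hD i j hij
    have hnot : e ∉ univ.biUnion D := by
      simp only [mem_biUnion, mem_univ, true_and, not_exists]
      exact fun j hj => (he j e hj).false
    rw [← sum_biUnion hdisj, add_comm, ← sum_insert hnot, ← hw.2]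
    exact sum_le_sum_of_subset_of_nonneg (subset_univ _) fun x _ _ => hw.1 x
  have hlower : (n : ℝ) * (t - w e) < ∑ j, ∑ x ∈ D j, w x := by
    calc (n : ℝ) * (t - w e) = ∑ _j : Fin n, (t - w e) := by simp [mul_sub]
      _ < _ := sum_lt_sum_of_nonempty ⟨⟨0, by omega⟩, mem_univ _⟩
        fun j _ => by linarith [hrefuse j]
  have hlarge : 1 < (((k : ℝ) + 1) * n + 1) * w e := by
    rw [div_le_iff₀ hN] at ht
    have h1 : (n : ℝ) * t < 1 + (n - 1) * w e := by linarith
    have h2 := mul_lt_mul_of_pos_right h1 hN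
    have h3 := mul_le_mul_of_nonneg_left ht (by positivity : (0 : ℝ) ≤ n)
    have h4 : ((n : ℝ) - 1) * 1 < (n - 1) * ((((k : ℝ) + 1) * n + 1) * w e) := by linarith
    exact lt_of_mul_lt_mul_left h4 (by linarith)
  have hcard : ∀ j, k + 1 ≤ (D j).card := fun j => by
    by_contra! hlt
    have h1 : ∑ x ∈ D j, w x ≤ (D j).card * α := by
      simpa using sum_le_card_nsmul (D j) w α fun x _ => hα x
    have h2 : ((D j).card : ℝ) * α ≤ k * α :=
      mul_le_mul_of_nonneg_right (by exact_mod_cast Nat.lt_succ_iff.1 hlt) hα0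
    linarith [hrefuse j, hα e]
  have hbag : ∀ j, ((k : ℝ) + 1) * w e ≤ ∑ x ∈ D j, w x := fun j => by
    calc ((k : ℝ) + 1) * w e ≤ (D j).card * w e :=
          mul_le_mul_of_nonneg_right (by exact_mod_cast hcard j) (hw.1 e)
      _ ≤ _ := by simpa using card_nsmul_le_sum (D j) w (w e) fun x hx => hanti (he j x hx).le
  have hsum : (n : ℝ) * (((k : ℝ) + 1) * w e) ≤ ∑ j, ∑ x ∈ D j, w x := by
    calc (n : ℝ) * (((k : ℝ) + 1) * w e) = ∑ _j : Fin n, ((k : ℝ) + 1) * w e := by simp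
      _ ≤ _ := sum_le_sum fun j _ => hbag j
  linarith

/-- Hill's guarantee is feasible when all agents rank the objects in the same order. -/
lemma exists_allocation_of_antitone {n m : ℕ} (hn : 2 ≤ n) {w : Fin n → Fin m → ℝ}
    (hw : ∀ i, IsDisutility m (w i)) (hanti : ∀ i, Antitone (w i)) {α : Fin n → ℝ}
    (hα0 : ∀ i, 0 ≤ α i) (hα : ∀ i e, w i e ≤ α i) :
    ∃ A : Fin m → Fin n, ∀ i, ∑ e with A e = i, w i e ≤ hillV n (α i) := by
  choose k hk hk' using fun i => exists_le_hillV n (α i)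
  have hT : ∀ i, 0 ≤ hillV n (α i) := fun i =>
    (mul_nonneg (by positivity) (hα0 i)).trans (hk' i)
  obtain ⟨B, -, hdisj, hBT, hB⟩ := exists_firstFit_allocation w (fun i => hillV n (α i)) hT univ
    ⟨⟨0, by omega⟩, mem_univ _⟩ univ
  have hcover : ∀ e, ∃ i, e ∈ B i := by
    by_contra! ⟨e, he⟩
    obtain ⟨i, -, hi⟩ := hB e (mem_univ e) fun i _ => he i
    exact not_refuse_all hn (hw i) (hanti i) (hα i) (hk i) (hk' i)
      (D := fun j => (B j).filter (· < e))
      (fun j l hjl => disjoint_filter_filter (hdisj j (mem_univ _) l (mem_univ _) hjl))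
      (fun j x hx => (mem_filter.1 hx).2) (fun j => hi j (mem_univ j))
  choose A hA using hcover
  refine ⟨A, fun i => le_trans ?_ (hBT i (mem_univ i))⟩
  refine sum_le_sum_of_subset_of_nonneg (fun e he => ?_) fun e _ _ => (hw i).1 e
  rw [← (mem_filter.1 he).2]
  exact hA e

/-- If position `p` is assigned to agent `A p`, the positions can be matched to distinct objects
so that each agent weakly prefers the object to the one at that position in its own ranking. -/
lemma exists_perm_le {ι : Type*} {m : ℕ} (v : ι → Fin m → ℝ) (σ : ι → Equiv.Perm (Fin m))
    (hσ : ∀ i, Antitone (v i ∘ σ i)) (A : Fin m → ι) :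
    ∃ π : Equiv.Perm (Fin m), ∀ p, v (A p) (π p) ≤ v (A p) (σ (A p) p) := by
  obtain ⟨f, hf, hft⟩ := (Finset.all_card_le_biUnion_card_iff_exists_injective
    fun p => (Ici p).map (σ (A p)).toEmbedding).1 fun P => by
      rcases P.eq_empty_or_nonempty with rfl | hP
      · simp
      · calc P.card ≤ (Ici (P.min' hP)).card :=
              card_le_card fun q hq => mem_Ici.2 (P.min'_le q hq)
          _ = ((Ici (P.min' hP)).map (σ (A (P.min' hP))).toEmbedding).card := (card_map _).symm
          _ ≤ _ := card_le_card (subset_biUnion_of_mem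
            (fun p => (Ici p).map (σ (A p)).toEmbedding) (P.min'_mem hP))
  refine ⟨Equiv.ofBijective f (Finite.injective_iff_bijective.1 hf), fun p => ?_⟩
  obtain ⟨q, hq, hqp⟩ := mem_map.1 (hft p)
  rw [Equiv.ofBijective_apply, ← hqp]
  exact hσ (A p) (mem_Ici.1 hq)

theorem stmt13 (n m : ℕ) (hn : 2 ≤ n) (hm : 1 ≤ m) (v : Fin n → Fin m → ℝ)
    (hv : ∀ i, IsDisutility m (v i)) :
    ∃ A : Fin m → Fin n, ∀ i : Fin n,
      ∑ e ∈ Finset.univ.filter (fun e => A e = i), v i e ≤ hillV n (⨆ e, v i e) := by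
  have hle : ∀ i e, v i e ≤ ⨆ e, v i e := fun i e => le_ciSup (Set.finite_range (v i)).bddAbove e
  let σ : Fin n → Equiv.Perm (Fin m) := fun i => Tuple.sort fun e => -v i e
  have hσ : ∀ i, Antitone (v i ∘ σ i) := fun i p q hpq =>
    neg_le_neg_iff.1 (Tuple.monotone_sort (fun e => -v i e) hpq)
  obtain ⟨A, hA⟩ := exists_allocation_of_antitone hn (w := fun i => v i ∘ σ i)
    (fun i => ⟨fun e => (hv i).1 _, ((σ i).sum_comp _ _ (by simp)).trans (hv i).2⟩) hσ
    (fun i => ((hv i).1 ⟨0, hm⟩).trans (hle i _)) fun i e => hle i (σ i e)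
  obtain ⟨π, hπ⟩ := exists_perm_le v σ hσ A
  refine ⟨A ∘ π.symm, fun i => le_trans ?_ (hA i)⟩
  have hreindex : ∑ e with (A ∘ π.symm) e = i, v i e = ∑ p with A p = i, v i (π p) := by
    rw [sum_filter, sum_filter, ← Equiv.sum_comp π]
    simp
  rw [hreindex]
  refine sum_le_sum fun p hp => ?_
  obtain rfl := (mem_filter.1 hp).2
  exact hπ p
end

section
/- Let n ≥ 2 be an integer and let α be a real with 0 < α ≤ 1. Then there exist an integer m ≥ 1 and disutility functions v'_1, …, v'_n on m objects, each satisfying v'_i e ≤ α for every object e, such that for every allocation B : Fin m → Fin n there is an agent i with ∑ of v'_i e over objects e with B e = i ≥ V_n(α). In other words, V_n(α) is the best possible guarantee over disutility functions whose single-object values are at most α. -/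
open Finset

/-- If more than `n * K` objects have disutility at least `c`, then every allocation to `n` agents
gives some agent a bundle of disutility at least `(K + 1) * c`. -/
theorem exists_bundle_ge {n m K : ℕ} {c : ℝ} (hc : 0 ≤ c) (v : Fin m → ℝ) (hv : ∀ e, 0 ≤ v e)
    (s : Finset (Fin m)) (hs : n * K < s.card) (hsv : ∀ e ∈ s, c ≤ v e) (B : Fin m → Fin n) :
    ∃ i : Fin n, ((K : ℝ) + 1) * c ≤ ∑ e ∈ univ.filter (fun e => B e = i), v e := by
  obtain ⟨i, -, hi⟩ := Finset.exists_lt_card_fiber_of_mul_lt_card_of_maps_to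
    (s := s) (t := univ) (f := B) (n := K) (fun _ _ => mem_univ _) (by simpa using hs)
  refine ⟨i, ?_⟩
  have hK : (K : ℝ) + 1 ≤ ((s.filter (fun e => B e = i)).card : ℝ) := by exact_mod_cast hi
  calc ((K : ℝ) + 1) * c ≤ (s.filter (fun e => B e = i)).card * c := by gcongr
    _ = ∑ _e ∈ s.filter (fun e => B e = i), c := by simp
    _ ≤ ∑ e ∈ s.filter (fun e => B e = i), v e :=
        sum_le_sum fun e he => hsv e (mem_filter.1 he).1
    _ ≤ ∑ e ∈ univ.filter (fun e => B e = i), v e :=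
        sum_le_sum_of_subset_of_nonneg (filter_subset_filter _ (subset_univ s))
          fun e _ _ => hv e

theorem stmt14 (n : ℕ) (hn : 2 ≤ n) (α : ℝ) (hα0 : 0 < α) (hα1 : α ≤ 1) :
    ∃ (m : ℕ), 1 ≤ m ∧ ∃ v : Fin n → Fin m → ℝ,
      (∀ i, IsDisutility m (v i)) ∧ (∀ i e, v i e ≤ α) ∧
      ∀ B : Fin m → Fin n, ∃ i : Fin n,
        hillV n α ≤ ∑ e ∈ Finset.univ.filter (fun e => B e = i), v i e := by
  have hn0 : (0 : ℝ) < n := by exact_mod_cast (by omega : 0 < n)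
  have hnonneg : 0 ≤ (1 / α - 1) / (n : ℝ) :=
    div_nonneg (sub_nonneg.2 ((one_le_div hα0).2 hα1)) hn0.le
  have hfloor := Nat.floor_le hnonneg
  have hlt := Nat.lt_floor_add_one ((1 / α - 1) / (n : ℝ))
  unfold hillV
  simp only
  generalize ⌊(1 / α - 1) / (n : ℝ)⌋₊ = k at hfloor hlt ⊢
  have hα_le : (k * n + 1) * α ≤ 1 := by
    rw [le_div_iff₀ hn0, le_sub_iff_add_le, le_div_iff₀ hα0] at hfloor
    exact hfloor
  have hα_gt : 1 < ((k + 1) * n + 1) * α := by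
    rw [div_lt_iff₀ hn0, sub_lt_iff_lt_add, div_lt_iff₀ hα0] at hlt
    exact hlt
  have hd : (0 : ℝ) < (k + 1) * n + 1 := by positivity
  split_ifs with h
  · have hc : (0 : ℝ) ≤ 1 / ((k + 1) * n + 1) := by positivity
    refine ⟨(k + 1) * n + 1, by omega, fun _ _ => 1 / ((k + 1) * n + 1),
      fun _ => ⟨fun _ => hc, ?_⟩, fun _ _ => ?_, fun B => ?_⟩
    · simp only [sum_const, card_univ, Fintype.card_fin, nsmul_eq_mul]
      push_cast
      field_simp
    · rw [div_le_iff₀ hd]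
      linarith
    · obtain ⟨i, hi⟩ := exists_bundle_ge (K := k + 1) hc (fun _ => 1 / ((k + 1) * n + 1))
        (fun _ => hc) univ (by rw [card_univ, Fintype.card_fin, mul_comm]; omega)
        (fun _ _ => le_rfl) B
      refine ⟨i, le_trans (le_of_eq ?_) hi⟩
      push_cast
      ring
  · set β : ℝ := (1 - (k * n + 1) * α) / n with hβ
    have hβ0 : 0 ≤ β := div_nonneg (by linarith) hn0.le
    have hβα : β ≤ α := by
      rw [hβ, div_le_iff₀ hn0]
      linarith
    let v : Fin (k * n + 1 + n) → ℝ := Fin.append (fun _ => α) (fun _ => β)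
    have hv : ∀ e, 0 ≤ v e := by
      intro e
      refine Fin.addCases (fun j => ?_) (fun j => ?_) e
      · simpa [v] using hα0.le
      · simpa [v] using hβ0
    refine ⟨k * n + 1 + n, by omega, fun _ => v, fun _ => ⟨hv, ?_⟩, fun _ e => ?_, fun B => ?_⟩
    · simp only [v, Fin.sum_univ_add, Fin.append_left, Fin.append_right, sum_const, card_univ,
        Fintype.card_fin, nsmul_eq_mul, hβ]
      push_cast
      field_simp
      ring
    · refine Fin.addCases (fun j => ?_) (fun j => ?_) e
      · simp [v]
      · simpa [v] using hβα
    · refine exists_bundle_ge hα0.le v hv (univ.map (Fin.castAddEmb n)) ?_ ?_ B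
      · rw [card_map, card_univ, Fintype.card_fin, mul_comm]
        omega
      · simp [v]
end

section
/- Let m ≥ 1 and let v₁ and v₂ be two disutility functions on the same m objects. Then there exists an allocation A : Fin m → Fin 2 such that, for i = 1, 2, the disutility of agent i's bundle satisfies ∑ of v_i e over objects e with A e = i ≤ Δ₂⊕(max_e v_i e). -/
open Finset

/-- The function `Δ₂⊕ : (0,1] → ℝ`.
For `α` in the `k`-range `(1/(2k+3), 1/(2k+1)]` with `k ≠ 1` (so `k = ⌊(1/α-1)/2⌋`):
`Δ₂⊕(α) = ((k+2)/(k+1))·(1−α)/2` on `(1/(2k+3), (k+2)/(2(k+1)²+k+2)]` and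
`Δ₂⊕(α) = (k+1)α` on `((k+2)/(2(k+1)²+k+2), 1/(2k+1)]`;
on `(1/5, 1/3]` (the case `k = 1`):
`Δ₂⊕(α) = (3−3α)/4` on `(1/5, 7/27]`, `Δ₂⊕(α) = α + (2−2α)/5` on `(7/27, 2/7]`,
and `Δ₂⊕(α) = 2α` on `(2/7, 1/3]`. -/
noncomputable def delta2 (α : ℝ) : ℝ :=
  if 1/5 < α ∧ α ≤ 1/3 then
    if α ≤ 7/27 then (3 - 3*α)/4
    else if α ≤ 2/7 then α + (2 - 2*α)/5
    else 2*α
  else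
    let k : ℕ := ⌊(1/α - 1)/2⌋₊
    if α ≤ ((k:ℝ)+2)/(2*((k:ℝ)+1)^2 + (k:ℝ) + 2) then (((k:ℝ)+2)/((k:ℝ)+1)) * (1-α)/2
    else ((k:ℝ)+1)*α

/-- The lower bounds on `delta2` that drive the partition argument. -/
lemma exists_delta2_bounds (α : ℝ) : ∃ k : ℕ,
    ((k : ℝ) + 1) * α ≤ delta2 α ∧
    ((k : ℝ) + 2) * (1 - α) ≤ (2 * (k : ℝ) + 2) * delta2 α ∧
    (k = 1 → 2 + 3 * α ≤ 5 * delta2 α) := by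
  unfold delta2
  split_ifs with h h1 h2
  · exact ⟨1, by push_cast; linarith, by push_cast; linarith, fun _ => by linarith⟩
  · exact ⟨1, by push_cast; linarith, by push_cast; linarith, fun _ => by linarith⟩
  · exact ⟨1, by push_cast; linarith, by push_cast; linarith, fun _ => by linarith⟩
  · refine ⟨⌊(1 / α - 1) / 2⌋₊, ?_⟩
    have hk1 : ⌊(1 / α - 1) / 2⌋₊ ≠ 1 := by
      intro hk
      rw [Nat.floor_eq_iff' one_ne_zero] at hk
      obtain ⟨hl, hu⟩ := hk
      push_cast at hl hu
      have hα : 0 < α := one_div_pos.mp (by linarith)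
      refine h ⟨?_, ?_⟩
      · have : 1 / α < 5 := by linarith
        rw [div_lt_iff₀ hα] at this
        linarith
      · have : 3 ≤ 1 / α := by linarith
        rw [le_div_iff₀ hα] at this
        linarith
    generalize ⌊(1 / α - 1) / 2⌋₊ = k at hk1
    have hk : (0 : ℝ) ≤ k := k.cast_nonneg
    have hN : (0 : ℝ) < 2 * ((k : ℝ) + 1) ^ 2 + k + 2 := by positivity
    dsimp only
    split_ifs with ht
    · rw [le_div_iff₀ hN] at ht
      refine ⟨?_, le_of_eq ?_, fun h => absurd h hk1⟩
      · rw [div_mul_eq_mul_div, div_div, le_div_iff₀ (by positivity)]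
        linarith
      · field_simp
    · rw [not_le, div_lt_iff₀ hN] at ht
      exact ⟨le_rfl, by linarith, fun h => absurd h hk1⟩

lemma half_le_of_bounds {k : ℕ} {α D : ℝ} (ha : ((k : ℝ) + 1) * α ≤ D)
    (hb : ((k : ℝ) + 2) * (1 - α) ≤ (2 * (k : ℝ) + 2) * D) : 1 / 2 ≤ D := by
  have hk : (0 : ℝ) ≤ k := k.cast_nonneg
  have h1 := mul_le_mul_of_nonneg_left ha (by positivity : (0 : ℝ) ≤ k + 2)
  have h2 := mul_le_mul_of_nonneg_left hb (by positivity : (0 : ℝ) ≤ k + 1)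
  have hN : (0 : ℝ) < 2 * (k : ℝ) ^ 2 + 5 * k + 4 := by positivity
  refine le_of_mul_le_mul_left ?_ hN
  linarith

lemma half_le_delta2 (α : ℝ) : 1 / 2 ≤ delta2 α := by
  obtain ⟨k, ha, hb, -⟩ := exists_delta2_bounds α
  exact half_le_of_bounds ha hb

/-- Linear consequences of the bounds on `delta2` that no longer distinguish `k = 1`. -/
lemma derived_bounds {k : ℕ} (hk : 1 ≤ k) {α D : ℝ} (ha : ((k : ℝ) + 1) * α ≤ D)
    (hb : ((k : ℝ) + 2) * (1 - α) ≤ (2 * (k : ℝ) + 2) * D)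
    (hc : k = 1 → 2 + 3 * α ≤ 5 * D) :
    (k : ℝ) + 1 + (k + 2) * α ≤ (2 * k + 3) * D ∧
    (k : ℝ) + 4 ≤ (2 * k + 7) * D ∧
    2 * (k : ℝ) + 6 ≤ (4 * k + 10) * D + α := by
  rcases hk.eq_or_lt with rfl | hk2
  · have hc := hc rfl
    norm_num at ha hb ⊢
    refine ⟨?_, ?_, ?_⟩ <;> linarith
  · have hk2 : (2 : ℝ) ≤ k := by exact_mod_cast hk2
    have hN : (0 : ℝ) < 2 * (k : ℝ) ^ 2 + 5 * k + 4 := by positivity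
    have key (p q : ℝ) (hp : 0 ≤ p) (hq : 0 ≤ q) :
        0 ≤ p * (D - (k + 1) * α) + q * ((2 * k + 2) * D - (k + 2) * (1 - α)) :=
      add_nonneg (mul_nonneg hp (by linarith)) (mul_nonneg hq (by linarith))
    refine ⟨?_, ?_, ?_⟩ <;> refine le_of_mul_le_mul_left ?_ hN
    · have := key (4 * k ^ 2 + 13 * k + 10) (2 * k ^ 2 + 4 * k + 1) (by positivity) (by positivity)
      nlinarith
    · have := key ((k + 2) * (2 * k + 7)) ((k + 1) * (2 * k + 7)) (by positivity) (by positivity)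
      nlinarith
    · have := key (4 * k ^ 2 + 16 * k + 18) (4 * k ^ 2 + 14 * k + 11) (by positivity)
        (by positivity)
      nlinarith

lemma sum_Ico_le_mul_of_antitone {x : ℕ → ℝ} (hx : Antitone x) {a b : ℕ} (hab : a ≤ b) :
    ∑ j ∈ Ico a b, x j ≤ ((b : ℝ) - a) * x a := by
  have := sum_le_card_nsmul (Ico a b) x (x a) fun j hj => hx (mem_Ico.mp hj).1
  rwa [Nat.card_Ico, nsmul_eq_mul, Nat.cast_sub hab] at this

lemma mul_le_sum_Ico {x : ℕ → ℝ} {a b : ℕ} (hab : a ≤ b) {c : ℝ} (hc : ∀ j < b, c ≤ x j) :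
    ((b : ℝ) - a) * c ≤ ∑ j ∈ Ico a b, x j := by
  have := card_nsmul_le_sum (Ico a b) x c fun j hj => hc j (mem_Ico.mp hj).2
  rwa [Nat.card_Ico, nsmul_eq_mul, Nat.cast_sub hab] at this

/-- The smallest `c - b` of the terms with index in `[a, c)` weigh at most their proportional
share. -/
lemma sum_Ico_mul_le_of_antitone {x : ℕ → ℝ} (hx : Antitone x) {a b c : ℕ} (hab : a ≤ b)
    (hbc : b ≤ c) :
    ((c : ℝ) - a) * ∑ j ∈ Ico b c, x j ≤ ((c : ℝ) - b) * ∑ j ∈ Ico a c, x j := by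
  have h1 := sum_Ico_le_mul_of_antitone hx hbc
  have h2 := mul_le_sum_Ico hab (c := x b) fun j hj => hx hj.le
  have hs := sum_Ico_consecutive x hab hbc
  have hab' : (0 : ℝ) ≤ (b : ℝ) - a := sub_nonneg.mpr (by exact_mod_cast hab)
  have hbc' : (0 : ℝ) ≤ (c : ℝ) - b := sub_nonneg.mpr (by exact_mod_cast hbc)
  have h3 := mul_le_mul_of_nonneg_left h1 hab'
  have h4 := mul_le_mul_of_nonneg_left h2 hbc'
  rw [← hs]
  linarith

/-- If no subset of weight in `[1 - D, D]` exists, items of weight at most `2 * D - 1` cannot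
turn a light set into a heavy one. -/
lemma light_dichotomy {x : ℕ → ℝ} {m r : ℕ} {D : ℝ} (hrm : r ≤ m)
    (hsum : ∑ j ∈ range m, x j = 1)
    (hsmall : ∀ j, r ≤ j → j < m → x j ≤ 2 * D - 1)
    (hno : ∀ S ⊆ range m, ∑ j ∈ S, x j ≤ D → ∑ j ∈ S, x j < 1 - D)
    {S : Finset ℕ} (hS : S ⊆ range r) (hSD : ∑ j ∈ S, x j ≤ D) :
    ∑ j ∈ S, x j < 1 - D ∧ D < ∑ j ∈ range r, x j - ∑ j ∈ S, x j := by
  have grow : ∀ t, r ≤ t → t ≤ m → ∑ j ∈ S, x j + ∑ j ∈ Ico r t, x j < 1 - D := by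
    intro t hrt
    induction t, hrt using Nat.le_induction with
    | base => intro _; simpa using hno S (hS.trans (range_subset_range.mpr hrm)) hSD
    | succ t hrt ih =>
      intro htm
      have h1 := ih (by omega)
      have hd : Disjoint S (Ico r (t + 1)) := by
        rw [disjoint_left]
        intro j hj hj'
        have := mem_range.mp (hS hj)
        have := (mem_Ico.mp hj').1
        omega
      rw [← sum_union hd]
      apply hno
      · refine union_subset (hS.trans (range_subset_range.mpr hrm)) fun j hj => ?_
        have := (mem_Ico.mp hj).2
        exact mem_range.mpr (by omega)
      · rw [sum_union hd, sum_Ico_succ_top hrt]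
        linarith [hsmall t hrt (by omega)]
  refine ⟨hno S (hS.trans (range_subset_range.mpr hrm)) hSD, ?_⟩
  have h1 := grow m hrm le_rfl
  have h2 := sum_range_add_sum_Ico x hrm
  linarith

lemma exists_balanced_subset_of_antitone {x : ℕ → ℝ} {m k : ℕ} {D : ℝ} (hm : 1 ≤ m)
    (hx : Antitone x) (h0 : ∀ j, 0 ≤ x j) (hsum : ∑ j ∈ range m, x j = 1)
    (ha : ((k : ℝ) + 1) * x 0 ≤ D)
    (hb : ((k : ℝ) + 2) * (1 - x 0) ≤ (2 * (k : ℝ) + 2) * D)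
    (hc : k = 1 → 2 + 3 * x 0 ≤ 5 * D) :
    ∃ S ⊆ range m, ∑ j ∈ S, x j ≤ D ∧ 1 - D ≤ ∑ j ∈ S, x j := by
  have hD := half_le_of_bounds ha hb
  rcases Nat.eq_zero_or_pos k with rfl | hk
  · norm_num at ha hb
    refine ⟨{0}, singleton_subset_iff.mpr (mem_range.mpr hm), ?_, ?_⟩ <;> rw [sum_singleton] <;> linarith
  obtain ⟨hc', hd, he⟩ := derived_bounds hk ha hb hc
  by_contra! hno
  have hex : ∃ r, r = m ∨ x r ≤ 2 * D - 1 := ⟨m, Or.inl rfl⟩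
  obtain ⟨r, hr, hmin⟩ : ∃ r, (r = m ∨ x r ≤ 2 * D - 1) ∧
      ∀ j < r, ¬(j = m ∨ x j ≤ 2 * D - 1) := by
    classical
    exact ⟨Nat.find hex, Nat.find_spec hex, fun j hj => Nat.find_min hex hj⟩
  have hrm : r ≤ m := by
    by_contra! h
    exact hmin m h (Or.inl rfl)
  have hbig : ∀ j < r, 2 * D - 1 < x j := fun j hj => not_le.mp fun h => hmin j hj (Or.inr h)
  have hsmall : ∀ j, r ≤ j → j < m → x j ≤ 2 * D - 1 := fun j hrj hjm =>
    (hx hrj).trans (hr.resolve_left (by omega))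
  have key {S : Finset ℕ} := light_dichotomy (S := S) hrm hsum hsmall hno
  have hle1 : ∑ j ∈ range r, x j ≤ 1 :=
    (sum_le_sum_of_subset_of_nonneg (range_subset_range.mpr hrm) fun j _ _ => h0 j).trans_eq hsum
  have hsplit (t : ℕ) (ht : t ≤ r) := sum_range_add_sum_Ico x ht
  have hlargest : ∑ j ∈ range (k + 1), x j ≤ D := by
    have := sum_Ico_le_mul_of_antitone hx (Nat.zero_le (k + 1))
    rw [← range_eq_Ico] at this
    push_cast at this
    linarith
  by_cases hr1 : r ≤ k + 1
  · have h1 := sum_le_sum_of_subset_of_nonneg (range_subset_range.mpr hr1) fun j _ _ => h0 j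
    have h2 := (key subset_rfl (h1.trans hlargest)).2
    linarith
  have hk1 := key (range_subset_range.mpr (by omega : k + 1 ≤ r)) hlargest
  have hs1 := hsplit (k + 1) (by omega)
  have hs0 := hsplit 1 (by omega)
  rw [sum_range_one] at hs0
  have htail := sum_Ico_le_mul_of_antitone hx (by omega : k + 1 ≤ r)
  by_cases hr2 : r ≤ 2 * k + 2
  · have h1 : ((r : ℝ) - (k + 1 : ℕ)) * x (k + 1) ≤ (k + 1) * x 0 := by
      refine mul_le_mul ?_ (hx (Nat.zero_le _)) (h0 _) (by positivity)
      have : (r : ℝ) ≤ 2 * k + 2 := by exact_mod_cast hr2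
      push_cast
      linarith
    linarith
  by_cases hr6 : 2 * k + 6 ≤ r
  · have h1 := mul_le_sum_Ico (by omega : 1 ≤ 2 * k + 6) (x := x) (c := x (2 * k + 5))
      fun j hj => hx (by omega)
    have h2 := sum_range_add_sum_Ico x (by omega : 1 ≤ 2 * k + 6)
    have h3 := sum_le_sum_of_subset_of_nonneg (range_subset_range.mpr hr6) fun j _ _ => h0 j
    have h4 := mul_lt_mul_of_pos_left (hbig (2 * k + 5) (by omega))
      (by positivity : (0 : ℝ) < 2 * k + 5)
    rw [sum_range_one] at h2
    push_cast at h1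
    linarith
  obtain rfl | rfl | rfl : r = 2 * k + 3 ∨ r = 2 * k + 4 ∨ r = 2 * k + 5 := by omega
  · have h1 := sum_Ico_mul_le_of_antitone hx (by omega : 1 ≤ k + 1)
      (by omega : k + 1 ≤ 2 * k + 3)
    have hT : D < ∑ j ∈ Ico (k + 1) (2 * k + 3), x j := by linarith
    have h2 := mul_lt_mul_of_pos_left hT (by positivity : (0 : ℝ) < 2 * k + 2)
    have h3 := mul_le_mul_of_nonneg_left
      (by linarith : ∑ j ∈ Ico 1 (2 * k + 3), x j ≤ 1 - x 0) (by positivity : (0 : ℝ) ≤ k + 2)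
    push_cast at h1
    linarith
  · have h1 := sum_Ico_mul_le_of_antitone hx (by omega : 1 ≤ k + 3)
      (by omega : k + 3 ≤ 2 * k + 4)
    have h2 := mul_le_sum_Ico (by omega : k + 3 ≤ 2 * k + 4) fun j hj => (hbig j hj).le
    have h3 := mul_le_mul_of_nonneg_left
      (by linarith : ∑ j ∈ Ico 1 (2 * k + 4), x j ≤ 1 - x 0) (by positivity : (0 : ℝ) ≤ k + 1)
    have hS : ∑ j ∈ insert 0 (Ico (k + 3) (2 * k + 4)), x j =
        x 0 + ∑ j ∈ Ico (k + 3) (2 * k + 4), x j := sum_insert (by simp)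
    have hlight := (key (S := insert 0 (Ico (k + 3) (2 * k + 4)))
      (fun j hj => by simp only [mem_insert, mem_Ico] at hj; exact mem_range.mpr (by omega))
      (by
        rw [hS]
        push_cast at h1
        refine le_of_mul_le_mul_left ?_ (by positivity : (0 : ℝ) < 2 * k + 3)
        linarith)).1
    rw [hS] at hlight
    push_cast at h2
    linarith
  · have hs2 := hsplit (k + 2) (by omega)
    rcases le_or_gt (∑ j ∈ range (k + 2), x j) D with h | h
    · have h1 := sum_Ico_mul_le_of_antitone hx (by omega : 1 ≤ k + 2)
        (by omega : k + 2 ≤ 2 * k + 5)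
      have hT : D < ∑ j ∈ Ico (k + 2) (2 * k + 5), x j := by
        linarith [(key (range_subset_range.mpr (by omega)) h).2]
      have h2 := mul_lt_mul_of_pos_left hT (by positivity : (0 : ℝ) < 2 * k + 4)
      have h3 := mul_le_mul_of_nonneg_left
        (by linarith : ∑ j ∈ Ico 1 (2 * k + 5), x j ≤ 1 - x 0) (by positivity : (0 : ℝ) ≤ k + 3)
      push_cast at h1
      have h4 := mul_le_mul_of_nonneg_left hb (by positivity : (0 : ℝ) ≤ k + 3)
      have h5 : (2 * (k : ℝ) + 4) * D < (k + 3) * (1 - x 0) := by linarith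
      have h6 := mul_lt_mul_of_pos_left h5 (by positivity : (0 : ℝ) < k + 2)
      linarith
    · have h1 := mul_le_sum_Ico (by omega : k + 2 ≤ 2 * k + 5) fun j hj => (hbig j hj).le
      push_cast at h1
      linarith

lemma exists_balanced_subset {m : ℕ} (hm : 1 ≤ m) {v : Fin m → ℝ} (hv : IsDisutility m v) :
    ∃ T : Finset (Fin m), ∑ e ∈ T, v e ≤ delta2 (⨆ e, v e) ∧
      ∑ e ∈ Tᶜ, v e ≤ delta2 (⨆ e, v e) := by
  obtain ⟨hv0, hv1⟩ := hv
  let σ := Tuple.sort fun e => -v e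
  have hσ : Antitone (v ∘ σ) := fun i j hij =>
    neg_le_neg_iff.mp (Tuple.monotone_sort (fun e => -v e) hij)
  let x : ℕ → ℝ := fun j => if h : j < m then v (σ ⟨j, h⟩) else 0
  have hxv (i : Fin m) : x i = v (σ i) := by simp [x]
  have h0 (j : ℕ) : 0 ≤ x j := by
    by_cases h : j < m
    · exact (hxv ⟨j, h⟩).symm ▸ hv0 _
    · simp [x, h]
  have hx : Antitone x := by
    intro i j hij
    by_cases h : j < m
    · have := hσ (show (⟨i, hij.trans_lt h⟩ : Fin m) ≤ ⟨j, h⟩ from hij)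
      simpa [x, h, hij.trans_lt h] using this
    · have : x j = 0 := by simp [x, h]
      exact this ▸ h0 i
  have hsum : ∑ j ∈ range m, x j = 1 := by
    rw [← Fin.sum_univ_eq_sum_range x m, ← hv1, ← Equiv.sum_comp σ v]
    exact sum_congr rfl fun i _ => hxv i
  have hsup : ⨆ e, v e = x 0 := by
    have : Nonempty (Fin m) := ⟨⟨0, hm⟩⟩
    refine le_antisymm (ciSup_le fun e => ?_) ?_
    · have := hxv (σ.symm e)
      rw [Equiv.apply_symm_apply] at this
      exact this ▸ hx (Nat.zero_le _)
    · exact hxv ⟨0, hm⟩ ▸ le_ciSup (Set.finite_range v).bddAbove _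
  rw [hsup]
  obtain ⟨k, ha, hb, hc⟩ := exists_delta2_bounds (x 0)
  obtain ⟨S, hS, hle, hge⟩ := exists_balanced_subset_of_antitone hm hx h0 hsum ha hb hc
  let T : Finset (Fin m) := univ.filter fun e => ((σ.symm e : Fin m) : ℕ) ∈ S
  have hT : ∑ e ∈ T, v e = ∑ j ∈ S, x j := by
    refine sum_bij (fun e _ => ((σ.symm e : Fin m) : ℕ)) (fun e he => (mem_filter.mp he).2)
      (fun a _ b _ h => σ.symm.injective (Fin.ext h)) (fun j hj => ?_) fun e _ => ?_
    · exact ⟨σ ⟨j, mem_range.mp (hS hj)⟩, by simpa [T] using hj, by simp⟩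
    · rw [hxv, Equiv.apply_symm_apply]
  have hTc := sum_add_sum_compl T v
  exact ⟨T, by linarith, by linarith⟩

theorem stmt15 (m : ℕ) (hm : 1 ≤ m) (v : Fin 2 → Fin m → ℝ)
    (hv : ∀ i, IsDisutility m (v i)) :
    ∃ A : Fin m → Fin 2, ∀ i : Fin 2,
      ∑ e ∈ Finset.univ.filter (fun e => A e = i), v i e ≤ delta2 (⨆ e, v i e) := by
  obtain ⟨T, hT, hTc⟩ := exists_balanced_subset hm (hv 0)
  obtain ⟨U, hU, hUc⟩ : ∃ U : Finset (Fin m), ∑ e ∈ U, v 0 e ≤ delta2 (⨆ e, v 0 e) ∧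
      ∑ e ∈ Uᶜ, v 1 e ≤ delta2 (⨆ e, v 1 e) := by
    have h1 := sum_add_sum_compl T (v 1)
    rw [(hv 1).2] at h1
    have h2 := half_le_delta2 (⨆ e, v 1 e)
    rcases le_total (∑ e ∈ T, v 1 e) (1 / 2) with h | h
    · exact ⟨Tᶜ, hTc, by rw [compl_compl]; linarith⟩
    · exact ⟨T, hT, by linarith⟩
  refine ⟨fun e => if e ∈ U then 0 else 1, Fin.forall_fin_two.mpr ⟨?_, ?_⟩⟩
  · convert hU using 2
    ext e
    simp
  · convert hUc using 2
    ext e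
    simp
end

section
/- Let n ≥ 3 and k ≥ 0 be integers and let α be a real with 0 < α ≤ 1. If (k+2)/((k+1)((k+1)n+1)) ≤ α ≤ 1/(kn+1), then (k+2)/((k+1)((k+1)(n−1)+1)) ≤ α/(1 − (1 − V_n(α))/(n−1)) ≤ 1/(k(n−1)+1). If instead 1/((k+1)n+1) < α < (k+2)/((k+1)((k+1)n+1)), then 1/((k+1)(n−1)+1) < α/(1 − (1 − V_n(α))/(n−1)) < (k+2)/((k+1)((k+1)(n−1)+1)). -/
open Finset

theorem floor_inv_sub_one_div_eq {n k : ℕ} {α : ℝ} (hn : 0 < n) (hα : 0 < α)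
    (h1 : 1 / (((k:ℝ) + 1) * n + 1) < α) (h2 : α ≤ 1 / ((k:ℝ) * n + 1)) :
    ⌊(1 / α - 1) / (n:ℝ)⌋₊ = k := by
  have hn' : (0:ℝ) < n := by exact_mod_cast hn
  have h3 : (k:ℝ) * n + 1 ≤ 1 / α := (le_one_div (by positivity) hα).2 h2
  have h4 : 1 / α < ((k:ℝ) + 1) * n + 1 := (one_div_lt hα (by positivity)).2 h1
  rw [Nat.floor_eq_iff (div_nonneg (by nlinarith [Nat.cast_nonneg (α := ℝ) k]) hn'.le)]
  exact ⟨(le_div_iff₀ hn').2 (by linarith), (div_lt_iff₀ hn').2 (by linarith)⟩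

theorem stmt16 (n k : ℕ) (hn : 3 ≤ n) (α : ℝ) (hα0 : 0 < α) (hα1 : α ≤ 1) :
    ((((k:ℝ)+2)/(((k:ℝ)+1)*(((k:ℝ)+1)*(n:ℝ)+1)) ≤ α ∧ α ≤ 1/((k:ℝ)*(n:ℝ)+1)) →
      ((k:ℝ)+2)/(((k:ℝ)+1)*(((k:ℝ)+1)*((n:ℝ)-1)+1)) ≤
        α/(1 - (1 - hillV n α)/((n:ℝ)-1)) ∧
      α/(1 - (1 - hillV n α)/((n:ℝ)-1)) ≤ 1/((k:ℝ)*((n:ℝ)-1)+1)) ∧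
    ((1/(((k:ℝ)+1)*(n:ℝ)+1) < α ∧ α < ((k:ℝ)+2)/(((k:ℝ)+1)*(((k:ℝ)+1)*(n:ℝ)+1))) →
      1/(((k:ℝ)+1)*((n:ℝ)-1)+1) < α/(1 - (1 - hillV n α)/((n:ℝ)-1)) ∧
      α/(1 - (1 - hillV n α)/((n:ℝ)-1)) < ((k:ℝ)+2)/(((k:ℝ)+1)*(((k:ℝ)+1)*((n:ℝ)-1)+1))) := by
  have hn0 : 0 < n := by omega
  have hk : (0:ℝ) ≤ k := k.cast_nonneg
  obtain ⟨m, hm⟩ : ∃ m : ℝ, m = (n:ℝ) - 1 := ⟨_, rfl⟩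
  have hnm : (n:ℝ) = m + 1 := by linarith
  have hm2 : 2 ≤ m := by
    have : (3:ℝ) ≤ n := by exact_mod_cast hn
    linarith
  have hm1 : 0 < m - 1 := by linarith
  have hm0 : 0 < m := by linarith
  have hpos : 0 < ((k:ℝ) + 1) * n + 1 := by positivity
  constructor
  · rintro ⟨h1, h2⟩
    have hlt : 1 / (((k:ℝ) + 1) * n + 1) < α := by
      refine lt_of_lt_of_le ?_ h1
      rw [div_lt_div_iff₀ hpos (by positivity)]
      nlinarith
    have hV : hillV n α = ((k:ℝ) + 1) * α := by
      simp only [hillV, floor_inv_sub_one_div_eq hn0 hα0 hlt h2, if_neg h1.not_gt]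
    have hden : 0 < m - 1 + ((k:ℝ) + 1) * α := by positivity
    have hratio : α / (1 - (1 - ((k:ℝ) + 1) * α) / m) = m * α / (m - 1 + ((k:ℝ) + 1) * α) := by
      rw [show 1 - (1 - ((k:ℝ) + 1) * α) / m = (m - 1 + ((k:ℝ) + 1) * α) / m by
        field_simp; ring, div_div_eq_mul_div, mul_comm α]
    rw [hV, ← hm, hratio]
    rw [hnm] at h1 h2
    rw [div_le_iff₀ (by positivity)] at h1
    rw [le_div_iff₀ (by positivity)] at h2
    constructor
    · rw [div_le_div_iff₀ (by positivity) hden]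
      nlinarith [mul_le_mul_of_nonneg_left h1 hm1.le]
    · rw [div_le_div_iff₀ hden (by positivity)]
      nlinarith [mul_le_mul_of_nonneg_left h2 hm1.le]
  · rintro ⟨h1, h2⟩
    have hle : α ≤ 1 / ((k:ℝ) * n + 1) := by
      refine h2.le.trans ?_
      rw [div_le_div_iff₀ (by positivity) (by positivity), hnm]
      nlinarith [mul_nonneg hk hm0.le, mul_nonneg (mul_nonneg hk hk) hm0.le]
    have hV : hillV n α = ((k:ℝ) + 2) / (((k:ℝ) + 1) * n + 1) := by
      simp only [hillV, floor_inv_sub_one_div_eq hn0 hα0 h1 hle, if_pos h2]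
    have hratio : α / (1 - (1 - ((k:ℝ) + 2) / (((k:ℝ) + 1) * (m + 1) + 1)) / m) =
        α * (((k:ℝ) + 1) * (m + 1) + 1) / (((k:ℝ) + 1) * m + 1) := by
      rw [show 1 - (1 - ((k:ℝ) + 2) / (((k:ℝ) + 1) * (m + 1) + 1)) / m =
        (((k:ℝ) + 1) * m + 1) / (((k:ℝ) + 1) * (m + 1) + 1) by field_simp; ring,
        div_div_eq_mul_div]
    rw [hV, ← hm, hnm, hratio]
    rw [hnm] at h1 h2
    rw [div_lt_iff₀ (by positivity)] at h1
    rw [lt_div_iff₀ (by positivity)] at h2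
    constructor
    · gcongr
    · rw [← div_div]
      gcongr
      rw [lt_div_iff₀ (by positivity)]
      linarith
end

section
/- Let n ≥ 2 and k ≥ 0 be integers and let α be a real with 1/((k+1)n+1) < α ≤ 1/(kn+1) and α < 1. Let v : Fin m → ℝ be nonincreasing (v e ≥ v e' whenever e ≤ e') with 0 ≤ v e ≤ α for every e and ∑ e, v e = 1. Let q < m be an index such that the sum of the first q values of v is at most V_n(α) while the sum of the first q+1 values exceeds V_n(α). Then the sum of the first q values of v is at least (1 − V_n(α))/(n − 1). -/
open Finset

theorem floor_inv_sub_one_div {n k : ℕ} (hn : 0 < n) {α : ℝ}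
    (hl : 1/(((k:ℝ)+1)*(n:ℝ)+1) < α) (hu : α ≤ 1/((k:ℝ)*(n:ℝ)+1)) :
    ⌊(1/α - 1)/(n:ℝ)⌋₊ = k := by
  have hn' : (0:ℝ) < n := by exact_mod_cast hn
  have hα : 0 < α := lt_trans (by positivity) hl
  have h1 : (k:ℝ)*n+1 ≤ 1/α := (le_one_div hα (by positivity)).mp hu
  have h2 : 1/α < ((k:ℝ)+1)*n+1 := (one_div_lt (by positivity) hα).mp hl
  rw [Nat.floor_eq_iff (div_nonneg (by nlinarith [mul_nonneg k.cast_nonneg hn'.le]) hn'.le),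
    le_div_iff₀ hn', div_lt_iff₀ hn']
  exact ⟨by linarith, by linarith⟩

theorem hillV_eq_max {n k : ℕ} (hn : 0 < n) {α : ℝ}
    (hl : 1/(((k:ℝ)+1)*(n:ℝ)+1) < α) (hu : α ≤ 1/((k:ℝ)*(n:ℝ)+1)) :
    hillV n α = max (((k:ℝ)+2)/(((k:ℝ)+1)*(n:ℝ)+1)) (((k:ℝ)+1)*α) := by
  have hk : (0:ℝ) < (k:ℝ)+1 := by positivity
  have hiff : α < ((k:ℝ)+2)/(((k:ℝ)+1)*(((k:ℝ)+1)*(n:ℝ)+1)) ↔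
      ((k:ℝ)+1)*α < ((k:ℝ)+2)/(((k:ℝ)+1)*(n:ℝ)+1) := by
    rw [mul_comm ((k:ℝ)+1) (((k:ℝ)+1)*(n:ℝ)+1), ← div_div, lt_div_iff₀ hk, mul_comm α]
  simp only [hillV, floor_inv_sub_one_div hn hl hu, hiff]
  split_ifs with h
  · exact (max_eq_left h.le).symm
  · exact (max_eq_right (not_lt.mp h)).symm

theorem card_filter_val_lt {m q : ℕ} (hq : q ≤ m) :
    (univ.filter (fun e : Fin m => (e:ℕ) < q)).card = q :=
  Fin.card_filter_val_lt.trans (min_eq_right hq)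

theorem sum_filter_val_lt_succ {m q : ℕ} (hq : q < m) (v : Fin m → ℝ) :
    ∑ e ∈ univ.filter (fun e : Fin m => (e:ℕ) < q + 1), v e =
      ∑ e ∈ univ.filter (fun e : Fin m => (e:ℕ) < q), v e + v ⟨q, hq⟩ := by
  have h : univ.filter (fun e : Fin m => (e:ℕ) < q + 1) =
      insert ⟨q, hq⟩ (univ.filter (fun e : Fin m => (e:ℕ) < q)) := by
    ext e
    simp only [mem_filter, mem_univ, true_and, mem_insert, Fin.ext_iff]
    omega
  rw [h, sum_insert (by simp), add_comm]

theorem stmt17 (n k m : ℕ) (hn : 2 ≤ n) (α : ℝ)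
    (hαl : 1/(((k:ℝ)+1)*(n:ℝ)+1) < α) (hαu : α ≤ 1/((k:ℝ)*(n:ℝ)+1)) (hα1 : α < 1)
    (v : Fin m → ℝ) (hmono : ∀ e e' : Fin m, e ≤ e' → v e' ≤ v e)
    (h0 : ∀ e, 0 ≤ v e) (hub : ∀ e, v e ≤ α) (hsum : ∑ e, v e = 1)
    (q : ℕ) (hq : q < m)
    (h1 : ∑ e ∈ Finset.univ.filter (fun e : Fin m => (e:ℕ) < q), v e ≤ hillV n α)
    (h2 : hillV n α < ∑ e ∈ Finset.univ.filter (fun e : Fin m => (e:ℕ) < q + 1), v e) :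
    (1 - hillV n α)/((n:ℝ)-1) ≤
      ∑ e ∈ Finset.univ.filter (fun e : Fin m => (e:ℕ) < q), v e := by
  have hV := hillV_eq_max (by omega) hαl hαu
  have hn1 : (0:ℝ) < (n:ℝ) - 1 := by
    have : (2:ℝ) ≤ n := by exact_mod_cast hn
    linarith
  have hα : 0 < α := lt_trans (by positivity) hαl
  have hVl : (k:ℝ)+2 ≤ hillV n α * (((k:ℝ)+1)*n+1) := by
    rw [← div_le_iff₀ (by positivity), hV]
    exact le_max_left _ _
  have hVα : ((k:ℝ)+1)*α ≤ hillV n α := hV ▸ le_max_right _ _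
  have hkq : (k:ℝ)+1 ≤ q := by
    by_contra! hlt
    have hqk : (q:ℝ)+1 ≤ (k:ℝ)+1 := by
      have : q < k + 1 := by exact_mod_cast hlt
      exact_mod_cast this
    have hT := sum_le_card_nsmul (univ.filter (fun e : Fin m => (e:ℕ) < q + 1)) v α
      (fun e _ => hub e)
    rw [card_filter_val_lt (Nat.succ_le_of_lt hq), nsmul_eq_mul, Nat.cast_succ] at hT
    linarith [mul_le_mul_of_nonneg_right hqk hα.le]
  have hS := card_nsmul_le_sum (univ.filter (fun e : Fin m => (e:ℕ) < q)) v (v ⟨q, hq⟩)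
    (fun e he => hmono _ _ (Fin.le_def.mpr (mem_filter.mp he).2.le))
  rw [card_filter_val_lt hq.le, nsmul_eq_mul] at hS
  rw [sum_filter_val_lt_succ hq] at h2
  set S := ∑ e ∈ univ.filter (fun e : Fin m => (e:ℕ) < q), v e
  have hkS : ((k:ℝ)+1) * v ⟨q, hq⟩ ≤ S :=
    (mul_le_mul_of_nonneg_right hkq (h0 _)).trans hS
  have hk1 : (0:ℝ) < (k:ℝ)+1 := by positivity
  have hk2 : (0:ℝ) < (k:ℝ)+2 := by positivity
  have hSV : ((k:ℝ)+1) * hillV n α ≤ ((k:ℝ)+2) * S := by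
    linarith [mul_lt_mul_of_pos_left h2 hk1]
  rw [div_le_iff₀ hn1]
  refine le_of_mul_le_mul_left ?_ hk2
  linarith [mul_le_mul_of_nonneg_right hSV hn1.le]
end

section
/- Let n ≥ 2 and m ≥ 1 be integers and let α be a real with 0 < α ≤ 1 and m ≥ ⌈1/α⌉. Then for any two disutility functions v, v' ∈ V(α;m) one has MMS_n(v) ≤ (2n/(n+1))·MMS_n(v'); that is, the ratio between the worst-case and best-case MinMaxShare over V(α;m) is at most 2n/(n+1) < 2. -/
open Finset

/-- The total value of the objects that `A` gives to agent `j`. -/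
noncomputable def load {n m : ℕ} (v : Fin m → ℝ) (A : Fin m → Fin n) (j : Fin n) : ℝ :=
  ∑ e ∈ Finset.univ.filter (fun e => A e = j), v e

lemma sum_load {n m : ℕ} (v : Fin m → ℝ) (A : Fin m → Fin n) :
    ∑ j, load v A j = ∑ e, v e :=
  Finset.sum_fiberwise _ _ _

lemma le_load {n m : ℕ} {v : Fin m → ℝ} (hv : ∀ e, 0 ≤ v e) (A : Fin m → Fin n)
    (e : Fin m) : v e ≤ load v A (A e) :=
  Finset.single_le_sum (f := v) (fun i _ => hv i) (by simp)

/-- Moving object `e` to agent `k` shifts its value from the load of `A e` to that of `k`. -/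
lemma load_update {n m : ℕ} (v : Fin m → ℝ) (A : Fin m → Fin n) (e : Fin m) (k i : Fin n) :
    load v (Function.update A e k) i =
      load v A i + (if k = i then v e else 0) - (if A e = i then v e else 0) := by
  simp only [load, Finset.sum_filter]
  rw [← Finset.add_sum_erase _ _ (Finset.mem_univ e),
    ← Finset.add_sum_erase _ (fun a => if A a = i then v a else 0) (Finset.mem_univ e)]
  have h : ∑ x ∈ Finset.univ.erase e, (if Function.update A e k x = i then v x else 0) =
      ∑ x ∈ Finset.univ.erase e, (if A x = i then v x else 0) :=
    Finset.sum_congr rfl fun x hx => by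
      rw [Function.update_of_ne (Finset.ne_of_mem_erase hx)]
  rw [h, Function.update_self]
  ring

/-- Some allocation cannot be improved by moving a single object of positive value. -/
lemma exists_locally_optimal {n m : ℕ} (hn : 0 < n) (v : Fin m → ℝ) :
    ∃ A : Fin m → Fin n, ∀ e, 0 < v e → ∀ k, k ≠ A e → load v A (A e) ≤ load v A k + v e := by
  have : NeZero n := ⟨hn.ne'⟩
  obtain ⟨A, hA⟩ := Finite.exists_min (fun A : Fin m → Fin n => ∑ j, load v A j ^ 2)
  refine ⟨A, fun e he k hk => ?_⟩
  have h := hA (Function.update A e k)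
  have hterm : ∀ i, load v (Function.update A e k) i ^ 2 = load v A i ^ 2 +
      (if k = i then 2 * v e * load v A i + v e ^ 2 else 0) +
      (if A e = i then v e ^ 2 - 2 * v e * load v A i else 0) := by
    intro i
    rw [load_update]
    by_cases h1 : k = i
    · have h2 : A e ≠ i := fun h2 => hk (h1.trans h2.symm)
      simp only [h1, h2, if_true, if_false]
      ring
    · by_cases h2 : A e = i <;> simp only [h1, h2, if_true, if_false] <;> ring
  simp only [hterm, Finset.sum_add_distrib, Finset.sum_ite_eq, Finset.mem_univ, if_true] at h
  have h3 : 0 ≤ v e * (load v A k + v e - load v A (A e)) := by linarith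
  linarith [nonneg_of_mul_nonneg_right h3 he]

lemma exists_pos_le_half_load {n m : ℕ} {v : Fin m → ℝ} (hv : ∀ e, 0 ≤ v e)
    (A : Fin m → Fin n) (j : Fin n) (h : ∀ e, v e < load v A j) (hj : 0 < load v A j) :
    ∃ e, A e = j ∧ 0 < v e ∧ 2 * v e ≤ load v A j := by
  obtain ⟨a, ha, hapos⟩ := Finset.exists_lt_of_sum_lt
    (s := Finset.univ.filter (fun e => A e = j)) (f := fun _ => (0 : ℝ)) (g := v)
    (by simpa [load] using hj)
  have hsplit := Finset.add_sum_erase _ v ha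
  have hrest : 0 < ∑ e ∈ (Finset.univ.filter (fun e => A e = j)).erase a, v e := by
    have := h a
    rw [load] at this
    linarith
  obtain ⟨b, hb, hbpos⟩ := Finset.exists_lt_of_sum_lt
    (s := (Finset.univ.filter (fun e => A e = j)).erase a) (f := fun _ => (0 : ℝ)) (g := v)
    (by simpa using hrest)
  have hb_le := Finset.single_le_sum (f := v) (fun i _ => hv i) hb
  have hab : v a + v b ≤ load v A j := by rw [load]; linarith
  rcases le_total (v a) (v b) with hle | hle
  · exact ⟨a, by simpa using ha, hapos, by linarith⟩
  · exact ⟨b, by simpa using Finset.mem_of_mem_erase hb, hbpos, by linarith⟩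

lemma exists_load_le {n m : ℕ} (hn : 0 < n) {v : Fin m → ℝ} (hv : IsDisutility m v) {α : ℝ}
    (hα : ∀ e, v e ≤ α) :
    ∃ A : Fin m → Fin n, ∀ j, load v A j ≤ max α (2 / ((n : ℝ) + 1)) := by
  obtain ⟨A, hA⟩ := exists_locally_optimal hn v
  refine ⟨A, fun j => ?_⟩
  by_contra! hlt
  obtain ⟨h1, h2⟩ := max_lt_iff.mp hlt
  have hpos : 0 < load v A j := lt_trans (by positivity) h2
  obtain ⟨e, rfl, he, hhalf⟩ :=
    exists_pos_le_half_load hv.1 A j (fun e => (hα e).trans_lt h1) hpos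
  have hother : ∀ k ∈ Finset.univ.erase (A e), load v A (A e) / 2 ≤ load v A k := fun k hk => by
    linarith [hA e he k (Finset.ne_of_mem_erase hk)]
  have hsum := Finset.card_nsmul_le_sum _ _ _ hother
  have htot := (Finset.add_sum_erase _ (load v A) (Finset.mem_univ (A e))).trans
    ((sum_load v A).trans hv.2)
  rw [Finset.card_erase_of_mem (Finset.mem_univ _), Finset.card_univ, Fintype.card_fin,
    nsmul_eq_mul, Nat.cast_pred hn] at hsum
  rw [div_lt_iff₀ (by positivity)] at h2
  linarith

lemma MMS_le {n m : ℕ} (hn : 0 < n) {v : Fin m → ℝ} {c : ℝ}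
    {A : Fin m → Fin n} (h : ∀ j, load v A j ≤ c) : MMS n m v ≤ c := by
  have : NeZero n := ⟨hn.ne'⟩
  exact (ciInf_le (Set.finite_range fun A : Fin m → Fin n => ⨆ j, load v A j).bddBelow A).trans
    (ciSup_le h)

lemma le_MMS {n m : ℕ} (hn : 0 < n) {v : Fin m → ℝ} {c : ℝ}
    (h : ∀ A : Fin m → Fin n, ∃ j, c ≤ load v A j) : c ≤ MMS n m v := by
  have : NeZero n := ⟨hn.ne'⟩
  refine le_ciInf fun A => ?_
  obtain ⟨j, hj⟩ := h A
  exact hj.trans (le_ciSup (Set.finite_range (load v A)).bddAbove j)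

lemma one_div_le_MMS {n m : ℕ} (hn : 0 < n) {v : Fin m → ℝ} (hv : IsDisutility m v) :
    1 / (n : ℝ) ≤ MMS n m v := by
  have : NeZero n := ⟨hn.ne'⟩
  refine le_MMS hn fun A => ?_
  have hn' : (n : ℝ) ≠ 0 := by exact_mod_cast hn.ne'
  obtain ⟨j, -, hj⟩ := Finset.exists_le_of_sum_le (s := Finset.univ)
    (f := fun _ : Fin n => 1 / (n : ℝ)) (g := load v A) Finset.univ_nonempty
    (by rw [sum_load, hv.2]; simp [hn'])
  exact ⟨j, hj⟩

theorem stmt18 (n m : ℕ) (hn : 2 ≤ n) (hm : 1 ≤ m) (α : ℝ) (hα0 : 0 < α) (hα1 : α ≤ 1)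
    (hmα : ⌈1/α⌉ ≤ (m : ℤ)) (v v' : Fin m → ℝ) (hv : Vmem α m v) (hv' : Vmem α m v') :
    MMS n m v ≤ (2*(n:ℝ)/((n:ℝ)+1)) * MMS n m v' := by
  have hn0 : 0 < n := by omega
  have hnR : (2 : ℝ) ≤ n := by exact_mod_cast hn
  have : NeZero m := ⟨by omega⟩
  obtain ⟨A, hA⟩ := exists_load_le hn0 hv.1 (α := α) fun e =>
    hv.2 ▸ le_ciSup (Set.finite_range v).bddAbove e
  have hα : α ≤ MMS n m v' := hv'.2 ▸ ciSup_le fun e =>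
    le_MMS hn0 fun B => ⟨B e, le_load hv'.1.1 B e⟩
  refine (MMS_le hn0 hA).trans (max_le ?_ ?_)
  · have hratio : 1 ≤ 2 * (n : ℝ) / ((n : ℝ) + 1) := by
      rw [le_div_iff₀ (by positivity)]
      linarith
    exact hα.trans (le_mul_of_one_le_left (hα0.le.trans hα) hratio)
  · calc 2 / ((n : ℝ) + 1) = 2 * (n : ℝ) / ((n : ℝ) + 1) * (1 / n) := by field_simp
      _ ≤ _ := mul_le_mul_of_nonneg_left (one_div_le_MMS hn0 hv'.1) (by positivity)
end
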